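/- arXiv:1301.1987 — 5 statements merged into one kernel-verified Lean document; each statement's English description precedes it below -/
import Mathlib

section
/- Let G(V,E,f⁰) be a graph with flags and let e be a regular edge of G (neither a bridge nor a self-loop). Then the Tutte polynomial for graphs with flags satisfies the contraction/cut relation 𝒯_G(x,y,t) = 𝒯_{G∨e}(x,y,t) + 𝒯_{G/e}(x,y,t). -/
/-!
# Statement 0

Let `G(V,E,f⁰)` be a graph with flags and let `e` be a regular edge of `G`
(neither a bridge nor a self-loop).  Then the Tutte polynomial for graphs with
flags satisfies the contraction/cut relation
`𝒯_G(x,y,t) = 𝒯_{G∨e}(x,y,t) + 𝒯_{G/e}(x,y,t)`.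

A graph with flags is modelled by finite vertex and edge sets, an incidence map
sending each edge to its (ordered pair of) end vertices, and the number
`flags = |f⁰|` of additional flags.  A spanning c-subgraph is determined by its
edge set `A`; it has all vertices, all flags of `f⁰`, plus two flags for each
cut edge of `E ∖ A`, so its number of flags is `|f⁰| + 2(|E| - |A|)`.
-/

/-- A graph with flags `G(V, E, f⁰)`: finite vertex and edge sets, each edge
incident to one or two end vertices (recorded as an ordered pair; a self-loop
has both components equal), together with a number `flags = |f⁰|` of
additional flags (half-edges attached to vertices). -/
structure FlagGraph where
  V : Type
  E : Type
  vFin : Fintype V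
  eFin : Fintype E
  eDec : DecidableEq E
  ends : E → V × V
  flags : ℕ

attribute [instance] FlagGraph.vFin FlagGraph.eFin FlagGraph.eDec

namespace FlagGraph

variable (G : FlagGraph)

/-- `u` and `v` are joined by some edge of the spanning c-subgraph with edge set `A`. -/
def adj (A : Finset G.E) (u v : G.V) : Prop :=
  ∃ e ∈ A, G.ends e = (u, v) ∨ G.ends e = (v, u)

/-- `k(A)`: the number of connected components of the spanning c-subgraph with
edge set `A` (it has all the vertices of `G`). -/
noncomputable def kc (A : Finset G.E) : ℕ :=
  Nat.card (Quot (G.adj A))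

/-- `r(G) - r(A) = k(A) - k(G)`, where `r(A) = |V| - k(A)` is the rank. -/
noncomputable def corank (A : Finset G.E) : ℕ :=
  G.kc A - G.kc Finset.univ

/-- The nullity `n(A) = |E_A| + k(A) - |V|`. -/
noncomputable def nullity (A : Finset G.E) : ℕ :=
  A.card + G.kc A - Fintype.card G.V

/-- `f(A)`: the number of flags of the spanning c-subgraph `A`, namely the
flags of `f⁰` together with the two flags obtained by cutting each edge not
in `A`. -/
def nflags (A : Finset G.E) : ℕ :=
  G.flags + 2 * (Fintype.card G.E - A.card)

/-- The Tutte polynomial of a graph with flags,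
`𝒯_G(x,y,t) = Σ_{A ⋐ G} (x-1)^{r(G)-r(A)} (y-1)^{n(A)} t^{f(A)}`. -/
noncomputable def T {K : Type*} [CommRing K] (x y t : K) : K :=
  ∑ A : Finset G.E,
    (x - 1) ^ G.corank A * (y - 1) ^ G.nullity A * t ^ G.nflags A

/-- A self-loop: both ends of `e` are incident to the same vertex. -/
def IsSelfLoop (e : G.E) : Prop := (G.ends e).1 = (G.ends e).2

/-- A bridge: removing `e` disconnects a component. -/
def IsBridge (e : G.E) : Prop :=
  G.kc (Finset.univ.erase e) = G.kc Finset.univ + 1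

/-- A regular (ordinary) edge: neither a bridge nor a self-loop. -/
def IsRegular (e : G.E) : Prop := ¬ G.IsSelfLoop e ∧ ¬ G.IsBridge e

/-- The graph `G − e` obtained by deleting the edge `e`. -/
def del (e : G.E) : FlagGraph where
  V := G.V
  E := {e' : G.E // e' ≠ e}
  vFin := G.vFin
  eFin := by infer_instance
  eDec := by infer_instance
  ends := fun e' => G.ends e'.1
  flags := G.flags

/-- The graph `G ∨ e` obtained by cutting the edge `e`: `e` is removed and two
flags are attached at its former end vertices. -/
def cut (e : G.E) : FlagGraph where
  V := G.V
  E := {e' : G.E // e' ≠ e}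
  vFin := G.vFin
  eFin := by infer_instance
  eDec := by infer_instance
  ends := fun e' => G.ends e'.1
  flags := G.flags + 2

/-- The relation identifying the two end vertices of `e`. -/
def contractRel (e : G.E) (u v : G.V) : Prop :=
  u = (G.ends e).1 ∧ v = (G.ends e).2

open scoped Classical in
/-- The graph `G/e` obtained by contracting the edge `e`: for a non-self-loop,
`e` is removed and its end vertices are identified into a single vertex
carrying all their remaining edges and flags; for a self-loop, `G/e := G − e`. -/
noncomputable def contract (e : G.E) : FlagGraph :=
  if G.IsSelfLoop e then G.del e
  else
    { V := Quot (G.contractRel e)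
      E := {e' : G.E // e' ≠ e}
      vFin := @Fintype.ofFinite _
        (Finite.of_surjective (Quot.mk (G.contractRel e))
          (fun q => Quot.inductionOn q fun v => ⟨v, rfl⟩))
      eFin := by infer_instance
      eDec := by infer_instance
      ends := fun e' =>
        (Quot.mk (G.contractRel e) (G.ends e'.1).1,
         Quot.mk (G.contractRel e) (G.ends e'.1).2)
      flags := G.flags }

end FlagGraph

/-- Quotienting `α` by `r` and then by `s` has the same cardinality as quotienting `α` by `t`,
when `t` identifies the same points. -/
theorem natCard_quot_quot {α : Type*} {r t : α → α → Prop} {s : Quot r → Quot r → Prop}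
    (hr : ∀ u v, r u v → Quot.mk t u = Quot.mk t v)
    (hs : ∀ u v, s (Quot.mk r u) (Quot.mk r v) → Quot.mk t u = Quot.mk t v)
    (ht : ∀ u v, t u v → Quot.mk s (Quot.mk r u) = Quot.mk s (Quot.mk r v)) :
    Nat.card (Quot s) = Nat.card (Quot t) :=
  Nat.card_congr
    { toFun := Quot.lift (Quot.lift (Quot.mk t) hr) (by
        rintro ⟨u⟩ ⟨v⟩ h
        exact hs u v h)
      invFun := Quot.lift (fun u => Quot.mk s (Quot.mk r u)) ht
      left_inv := by rintro ⟨⟨u⟩⟩; rfl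
      right_inv := by rintro ⟨u⟩; rfl }

/-- Identifying two distinct points of a finite type lowers its cardinality by one. -/
theorem natCard_quot_pair_add_one {α : Type*} [Finite α] {a b : α} (hab : a ≠ b) :
    Nat.card (Quot fun u v => u = a ∧ v = b) + 1 = Nat.card α := by
  classical
  have hcard : Nat.card (Quot fun u v => u = a ∧ v = b) = Nat.card {x : α // x ≠ b} :=
    Nat.card_congr
      { toFun := Quot.lift (fun v => if h : v = b then ⟨a, hab⟩ else ⟨v, h⟩) (by
          rintro u v ⟨rfl, rfl⟩
          simp [hab])
        invFun := fun x => Quot.mk _ x.1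
        left_inv := by
          rintro ⟨v⟩
          by_cases h : v = b
          · simpa [h] using Quot.sound ⟨rfl, rfl⟩
          · simp [h]
        right_inv := by
          rintro ⟨x, hx⟩
          simp [hx] }
  have := Fintype.ofFinite α
  have hpos : 0 < Fintype.card α := Fintype.card_pos_iff.mpr ⟨a⟩
  rw [hcard, Nat.card_eq_fintype_card, Nat.card_eq_fintype_card, Fintype.card_subtype_compl,
    Fintype.card_subtype_eq]
  omega

/-- A sum over all finite subsets, split according to whether they contain `e`. -/
theorem sum_finset_eq_sum_subtype_ne {E M : Type*} [Fintype E] [DecidableEq E]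
    [AddCommMonoid M] (e : E) (f : Finset E → M) :
    ∑ A, f A = ∑ A : Finset {e' : E // e' ≠ e}, f (A.map (Function.Embedding.subtype _)) +
      ∑ A : Finset {e' : E // e' ≠ e}, f (insert e (A.map (Function.Embedding.subtype _))) := by
  have key : ∀ g : Finset E → M, ∑ A ∈ (Finset.univ.erase e).powerset, g A =
      ∑ A : Finset {e' : E // e' ≠ e}, g (A.map (Function.Embedding.subtype _)) := by
    intro g
    symm
    refine Finset.sum_bij (fun A _ => A.map (Function.Embedding.subtype _)) ?_ ?_ ?_ ?_
    · intro A _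
      rw [Finset.mem_powerset]
      intro x hx
      obtain ⟨y, -, rfl⟩ := Finset.mem_map.1 hx
      exact Finset.mem_erase.2 ⟨y.2, Finset.mem_univ _⟩
    · intro A _ B _ h
      exact Finset.map_injective _ h
    · intro B hB
      refine ⟨B.subtype _, Finset.mem_univ _, Finset.subtype_map_of_mem fun x hx => ?_⟩
      exact Finset.ne_of_mem_erase (Finset.mem_powerset.1 hB hx)
    · intro A _
      rfl
  rw [← key f, ← key fun A => f (insert e A), ← Finset.sum_powerset_insert (by simp),
    Finset.insert_erase (Finset.mem_univ e), Finset.powerset_univ]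

namespace FlagGraph

variable (G : FlagGraph)

/-- Adding an edge identifies the components of its two ends. -/
theorem kc_insert (e : G.E) (A : Finset G.E) :
    G.kc (insert e A) = Nat.card (Quot fun p q : Quot (G.adj A) =>
      p = Quot.mk _ (G.ends e).1 ∧ q = Quot.mk _ (G.ends e).2) := by
  have lift : ∀ u v, Quot.mk (G.adj A) u = Quot.mk (G.adj A) v →
      Quot.mk (G.adj (insert e A)) u = Quot.mk (G.adj (insert e A)) v := by
    intro u v h
    exact congrArg (Quot.map id fun _ _ ⟨a, ha, h⟩ => ⟨a, Finset.mem_insert_of_mem ha, h⟩) h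
  symm
  refine natCard_quot_quot (fun u v h => lift u v (Quot.sound h)) ?_ ?_
  · rintro u v ⟨hu, hv⟩
    rw [lift _ _ hu, lift _ _ hv]
    exact Quot.sound ⟨e, Finset.mem_insert_self _ _, Or.inl rfl⟩
  · rintro u v ⟨a, ha, h⟩
    rcases Finset.mem_insert.1 ha with rfl | ha
    · rcases h with h | h
      · exact Quot.sound (by simp [h])
      · exact (Quot.sound (by simp [h])).symm
    · exact congrArg _ (Quot.sound ⟨a, ha, h⟩)

theorem kc_eq_kc_insert_or (e : G.E) (A : Finset G.E) :
    G.kc A = G.kc (insert e A) ∨ G.kc A = G.kc (insert e A) + 1 := by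
  rw [kc_insert]
  by_cases hab : Quot.mk (G.adj A) (G.ends e).1 = Quot.mk (G.adj A) (G.ends e).2
  · left
    rw [hab]
    exact Nat.card_congr
      { toFun := Quot.mk _
        invFun := Quot.lift id (by rintro u v ⟨rfl, rfl⟩; rfl)
        left_inv := fun _ => rfl
        right_inv := by rintro ⟨u⟩; rfl }
  · right
    have : Finite (Quot (G.adj A)) := Finite.of_surjective _ Quot.mk_surjective
    exact (natCard_quot_pair_add_one hab).symm

variable {G} {e : G.E}

theorem kc_erase_of_not_isBridge (he : ¬ G.IsBridge e) :
    G.kc (Finset.univ.erase e) = G.kc Finset.univ := by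
  have := G.kc_eq_kc_insert_or e (Finset.univ.erase e)
  rw [Finset.insert_erase (Finset.mem_univ e)] at this
  exact this.resolve_right he

theorem map_subtype_univ_eq_erase :
    (Finset.univ : Finset {e' : G.E // e' ≠ e}).map (Function.Embedding.subtype _) =
      Finset.univ.erase e := by
  ext x
  simp

theorem card_subtype_ne_add_one : Fintype.card {e' : G.E // e' ≠ e} + 1 = Fintype.card G.E := by
  have h : 0 < Fintype.card G.E := Fintype.card_pos_iff.mpr ⟨e⟩
  rw [Fintype.card_subtype_compl, Fintype.card_subtype_eq]
  omega

theorem kc_cut (A : Finset {e' : G.E // e' ≠ e}) :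
    (G.cut e).kc A = G.kc (A.map (Function.Embedding.subtype _)) := by
  have : (G.cut e).adj A = G.adj (A.map (Function.Embedding.subtype _)) := by
    funext u v
    simp [adj, cut]
    rfl
  unfold kc
  rw [this]
  rfl

theorem T_cut {K : Type*} [CommRing K] (x y t : K) (he : ¬ G.IsBridge e) :
    (G.cut e).T x y t = ∑ A : Finset {e' : G.E // e' ≠ e},
      (x - 1) ^ G.corank (A.map (Function.Embedding.subtype _)) *
        (y - 1) ^ G.nullity (A.map (Function.Embedding.subtype _)) *
        t ^ G.nflags (A.map (Function.Embedding.subtype _)) := by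
  refine Finset.sum_congr rfl fun (A : Finset {e' : G.E // e' ≠ e}) _ => ?_
  have h1 : (G.cut e).corank A = G.corank (A.map (Function.Embedding.subtype _)) := by
    have hu : (G.cut e).kc Finset.univ = G.kc Finset.univ := by
      rw [← kc_erase_of_not_isBridge he, ← map_subtype_univ_eq_erase]
      exact kc_cut _
    unfold corank
    rw [hu, kc_cut]
  have h2 : (G.cut e).nullity A = G.nullity (A.map (Function.Embedding.subtype _)) := by
    unfold nullity
    rw [kc_cut, Finset.card_map]
    rfl
  have h3 : (G.cut e).nflags A = G.nflags (A.map (Function.Embedding.subtype _)) := by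
    have hA := A.card_le_univ
    have hE := card_subtype_ne_add_one (e := e)
    unfold nflags
    rw [Finset.card_map]
    change G.flags + 2 + 2 * (Fintype.card {e' : G.E // e' ≠ e} - A.card) = _
    omega
  rw [h1, h2, h3]

/-- The contraction of `e` as in the non-loop case. -/
noncomputable def identifyEnds (G : FlagGraph) (e : G.E) : FlagGraph where
  V := Quot (G.contractRel e)
  E := {e' : G.E // e' ≠ e}
  vFin := @Fintype.ofFinite _
    (Finite.of_surjective (Quot.mk (G.contractRel e))
      (fun q => Quot.inductionOn q fun v => ⟨v, rfl⟩))
  eFin := by infer_instance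
  eDec := by infer_instance
  ends := fun e' =>
    (Quot.mk (G.contractRel e) (G.ends e'.1).1,
     Quot.mk (G.contractRel e) (G.ends e'.1).2)
  flags := G.flags

theorem contract_of_not_isSelfLoop (he : ¬ G.IsSelfLoop e) :
    G.contract e = G.identifyEnds e :=
  if_neg he

theorem kc_identifyEnds (A : Finset {e' : G.E // e' ≠ e}) :
    (G.identifyEnds e).kc A = G.kc (insert e (A.map (Function.Embedding.subtype _))) := by
  set B := insert e (A.map (Function.Embedding.subtype _)) with hB
  have hr : ∀ u v, G.contractRel e u v → Quot.mk (G.adj B) u = Quot.mk (G.adj B) v := by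
    rintro u v ⟨rfl, rfl⟩
    exact Quot.sound ⟨e, Finset.mem_insert_self _ _, Or.inl rfl⟩
  have lift : ∀ u v, Quot.mk (G.contractRel e) u = Quot.mk (G.contractRel e) v →
      Quot.mk (G.adj B) u = Quot.mk (G.adj B) v :=
    fun u v h => congrArg (Quot.lift _ hr) h
  refine natCard_quot_quot hr ?_ ?_
  · rintro u v ⟨a, ha, h⟩
    have hab : Quot.mk (G.adj B) (G.ends a.1).1 = Quot.mk (G.adj B) (G.ends a.1).2 :=
      Quot.sound ⟨a.1, Finset.mem_insert_of_mem (Finset.mem_map_of_mem _ ha), Or.inl rfl⟩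
    rcases h with h | h
    · obtain ⟨h1, h2⟩ := Prod.mk.inj h
      rw [← lift _ _ h1, ← lift _ _ h2, hab]
    · obtain ⟨h1, h2⟩ := Prod.mk.inj h
      rw [← lift _ _ h1, ← lift _ _ h2, hab]
  · rintro u v ⟨a, ha, h⟩
    rcases Finset.mem_insert.1 ha with rfl | ha
    · refine congrArg _ ?_
      rcases h with h | h
      · exact Quot.sound (by simp [contractRel, h])
      · exact (Quot.sound (by simp [contractRel, h])).symm
    · obtain ⟨a', ha', rfl⟩ := Finset.mem_map.1 ha
      refine Quot.sound ⟨a', ha', ?_⟩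
      rcases h with h | h
      · left
        exact congrArg (Prod.map (Quot.mk _) (Quot.mk _)) h
      · right
        exact congrArg (Prod.map (Quot.mk _) (Quot.mk _)) h

theorem T_identifyEnds {K : Type*} [CommRing K] (x y t : K) (he : ¬ G.IsSelfLoop e) :
    (G.identifyEnds e).T x y t = ∑ A : Finset {e' : G.E // e' ≠ e},
      (x - 1) ^ G.corank (insert e (A.map (Function.Embedding.subtype _))) *
        (y - 1) ^ G.nullity (insert e (A.map (Function.Embedding.subtype _))) *
        t ^ G.nflags (insert e (A.map (Function.Embedding.subtype _))) := by
  refine Finset.sum_congr rfl fun (A : Finset {e' : G.E // e' ≠ e}) _ => ?_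
  have hcard : (insert e (A.map (Function.Embedding.subtype _))).card = A.card + 1 := by
    rw [Finset.card_insert_of_notMem (by simp), Finset.card_map]
  have h1 : (G.identifyEnds e).corank A =
      G.corank (insert e (A.map (Function.Embedding.subtype _))) := by
    have hu : (G.identifyEnds e).kc Finset.univ = G.kc Finset.univ := by
      rw [← Finset.insert_erase (Finset.mem_univ e), ← map_subtype_univ_eq_erase]
      exact kc_identifyEnds _
    unfold corank
    rw [hu, kc_identifyEnds]
  have h2 : (G.identifyEnds e).nullity A =
      G.nullity (insert e (A.map (Function.Embedding.subtype _))) := by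
    have hV : Fintype.card (G.identifyEnds e).V + 1 = Fintype.card G.V := by
      rw [← Nat.card_eq_fintype_card, ← Nat.card_eq_fintype_card]
      exact natCard_quot_pair_add_one he
    unfold nullity
    rw [kc_identifyEnds, hcard]
    rw [← hV, Nat.add_right_comm]
    exact (Nat.add_sub_add_right _ 1 _).symm
  have h3 : (G.identifyEnds e).nflags A =
      G.nflags (insert e (A.map (Function.Embedding.subtype _))) := by
    have hE := card_subtype_ne_add_one (e := e)
    unfold nflags
    rw [hcard]
    change G.flags + 2 * (Fintype.card {e' : G.E // e' ≠ e} - A.card) = _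
    omega
  rw [h1, h2, h3]

end FlagGraph

/-- For a regular edge `e` of a graph with flags `G`, the
Tutte polynomial with flags satisfies `𝒯_G = 𝒯_{G∨e} + 𝒯_{G/e}`. -/
theorem tutte_flags_contraction_cut
    {K : Type*} [CommRing K] (x y t : K)
    (G : FlagGraph) (e : G.E) (he : G.IsRegular e) :
    G.T x y t = (G.cut e).T x y t + (G.contract e).T x y t := by
  rw [FlagGraph.contract_of_not_isSelfLoop he.1, FlagGraph.T_cut x y t he.2,
    FlagGraph.T_identifyEnds x y t he.1]
  exact sum_finset_eq_sum_subtype_ne e _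
end

section
/- Let G(V,E,f⁰) be a graph with flags and let e be a self-loop of G. Then 𝒯_{G/e}(x,y,t) = 𝒯_{G−e}(x,y,t) = t^{−2} 𝒯_{G∨e}(x,y,t), and 𝒯_G(x,y,t) = (y − 1 + t²) · 𝒯_{G−e}(x,y,t). -/
namespace FlagGraph

theorem card_quot_eq_of_imp_or_eq {α : Type*} {r s : α → α → Prop}
    (hrs : ∀ a b, r a b → s a b) (hsr : ∀ a b, s a b → r a b ∨ a = b) :
    Nat.card (Quot r) = Nat.card (Quot s) :=
  Nat.card_congr
    { toFun := Quot.map id hrs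
      invFun := Quot.lift (Quot.mk r) fun a b h =>
        (hsr a b h).elim (fun h => Quot.sound h) fun h => congrArg _ h
      left_inv := by rintro ⟨a⟩; rfl
      right_inv := by rintro ⟨a⟩; rfl }

/-- A function on vertices that agrees at the ends of every edge of `A` factors through the
components of `A`, so rank-nullity bounds the number of vertices. -/
theorem card_le_card_add_kc (G : FlagGraph) (A : Finset G.E) :
    Fintype.card G.V ≤ A.card + G.kc A := by
  classical
  have : Finite (Quot (G.adj A)) := Quot.finite _
  have : Fintype (Quot (G.adj A)) := Fintype.ofFinite _
  let d : (G.V → ℚ) →ₗ[ℚ] (A → ℚ) :=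
    LinearMap.funLeft ℚ ℚ (fun e : A => (G.ends e.1).1) -
      LinearMap.funLeft ℚ ℚ (fun e : A => (G.ends e.1).2)
  let c : (Quot (G.adj A) → ℚ) →ₗ[ℚ] (G.V → ℚ) := LinearMap.funLeft ℚ ℚ (Quot.mk _)
  have hker : LinearMap.ker d ≤ LinearMap.range c := by
    intro f hf
    have hf' (e : G.E) (he : e ∈ A) : f (G.ends e).1 = f (G.ends e).2 :=
      sub_eq_zero.mp (congrFun (LinearMap.mem_ker.mp hf) ⟨e, he⟩)
    refine ⟨Quot.lift f ?_, rfl⟩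
    rintro u v ⟨e, he, h | h⟩
    · simpa [h] using hf' e he
    · simpa [h] using (hf' e he).symm
  have h₁ := LinearMap.finrank_range_add_finrank_ker d
  have h₂ := (LinearMap.range d).finrank_le
  have h₃ := (Submodule.finrank_mono hker).trans (LinearMap.finrank_range_le c)
  simp only [Module.finrank_fintype_fun_eq_card, Fintype.card_coe] at h₁ h₂ h₃
  rw [kc, Nat.card_eq_fintype_card]
  omega

variable {G : FlagGraph} {e : G.E}

theorem kc_insert_of_isSelfLoop (he : G.IsSelfLoop e) (A : Finset G.E) :
    G.kc (insert e A) = G.kc A := by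
  refine (card_quot_eq_of_imp_or_eq ?_ ?_).symm
  · rintro u v ⟨a, ha, h⟩
    exact ⟨a, Finset.mem_insert_of_mem ha, h⟩
  · rintro u v ⟨a, ha, h⟩
    rcases Finset.mem_insert.mp ha with rfl | ha
    · right
      rcases h with h | h <;> simp_all [IsSelfLoop]
    · exact Or.inl ⟨a, ha, h⟩

/-- The edges of `G` underlying a set of edges of `G.del e`. -/
def delEdges (e : G.E) (B : Finset (G.del e).E) : Finset G.E :=
  Finset.map (Function.Embedding.subtype _) B

theorem mem_delEdges {B : Finset (G.del e).E} {a : G.E} :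
    a ∈ delEdges e B ↔ ∃ h : a ≠ e, (⟨a, h⟩ : {a' : G.E // a' ≠ e}) ∈ B := by
  unfold delEdges
  exact Finset.mem_map.trans
    ⟨by rintro ⟨b, hb, rfl⟩; exact ⟨b.2, hb⟩, by rintro ⟨h, hb⟩; exact ⟨_, hb, rfl⟩⟩

theorem notMem_delEdges (B : Finset (G.del e).E) : e ∉ delEdges e B :=
  fun h => (mem_delEdges.mp h).1 rfl

theorem card_delEdges (B : Finset (G.del e).E) : (delEdges e B).card = B.card :=
  Finset.card_map _

theorem insert_delEdges_univ : insert e (delEdges e Finset.univ) = Finset.univ := by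
  ext a
  by_cases h : a = e
  · simp [h]
  · exact iff_of_true (Finset.mem_insert_of_mem (mem_delEdges.mpr
      ⟨h, Finset.mem_univ (α := (G.del e).E) _⟩)) (Finset.mem_univ _)

theorem card_del_add_one : Fintype.card (G.del e).E + 1 = Fintype.card G.E := by
  rw [← Finset.card_univ, ← Finset.card_univ, ← insert_delEdges_univ (e := e),
    Finset.card_insert_of_notMem (notMem_delEdges _), card_delEdges]

theorem kc_delEdges (B : Finset (G.del e).E) : G.kc (delEdges e B) = (G.del e).kc B := by
  refine card_quot_eq_of_imp_or_eq (α := G.V) ?_ ?_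
  · rintro u v ⟨a, ha, h⟩
    obtain ⟨hne, ha⟩ := mem_delEdges.mp ha
    exact ⟨⟨a, hne⟩, ha, h⟩
  · rintro u v ⟨a, ha, h⟩
    exact Or.inl ⟨a.1, mem_delEdges.mpr ⟨a.2, ha⟩, h⟩

theorem kc_univ_of_isSelfLoop (he : G.IsSelfLoop e) :
    G.kc Finset.univ = (G.del e).kc Finset.univ := by
  rw [← insert_delEdges_univ (e := e), kc_insert_of_isSelfLoop he, kc_delEdges]

theorem sum_finset_edges {M : Type*} [AddCommMonoid M] (e : G.E) (f : Finset G.E → M) :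
    ∑ A : Finset G.E, f A =
      ∑ B : Finset (G.del e).E, (f (delEdges e B) + f (insert e (delEdges e B))) := by
  rw [← Finset.powerset_univ, ← insert_delEdges_univ (e := e),
    Finset.sum_powerset_insert (notMem_delEdges _), ← Finset.sum_add_distrib]
  symm
  refine Finset.sum_bij (fun B _ => delEdges e B) ?_ ?_ ?_ fun _ _ => rfl
  · intro B _
    exact Finset.mem_powerset.mpr (Finset.map_subset_map.mpr (Finset.subset_univ B))
  · intro B _ C _ h
    exact Finset.map_injective _ h
  · intro A hA
    obtain ⟨B, -, rfl⟩ := Finset.subset_map_iff.mp (Finset.mem_powerset.mp hA)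
    exact ⟨B, Finset.mem_univ _, rfl⟩

theorem T_cut_s3 {K : Type*} [CommRing K] (x y t : K) (e : G.E) :
    (G.cut e).T x y t = t ^ 2 * (G.del e).T x y t := by
  rw [T, T, Finset.mul_sum]
  refine Finset.sum_congr rfl fun (B : Finset (G.del e).E) _ => ?_
  have hf : (G.cut e).nflags B = (G.del e).nflags B + 2 :=
    Nat.add_right_comm G.flags 2 _
  rw [hf, pow_add]
  change (x - 1) ^ (G.del e).corank B * (y - 1) ^ (G.del e).nullity B * _ = _
  ring

theorem T_of_isSelfLoop {K : Type*} [CommRing K] (x y t : K) (he : G.IsSelfLoop e) :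
    G.T x y t = (y - 1 + t ^ 2) * (G.del e).T x y t := by
  rw [T, T, sum_finset_edges e, Finset.mul_sum]
  refine Finset.sum_congr rfl fun B _ => ?_
  have hB := (G.del e).card_le_card_add_kc B
  have hV : Fintype.card (G.del e).V = Fintype.card G.V := rfl
  have hF : (G.del e).flags = G.flags := rfl
  have hE := card_del_add_one (e := e)
  have hBE := Finset.card_le_univ B
  have hcard := Finset.card_insert_of_notMem (notMem_delEdges B)
  rw [card_delEdges] at hcard
  have hc₀ : G.corank (delEdges e B) = (G.del e).corank B := by
    rw [corank, corank, kc_delEdges, kc_univ_of_isSelfLoop he]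
  have hc₁ : G.corank (insert e (delEdges e B)) = (G.del e).corank B := by
    rw [corank, kc_insert_of_isSelfLoop he]
    exact hc₀
  have hn₀ : G.nullity (delEdges e B) = (G.del e).nullity B := by
    rw [nullity, nullity, kc_delEdges, card_delEdges, hV]
  have hn₁ : G.nullity (insert e (delEdges e B)) = (G.del e).nullity B + 1 := by
    rw [nullity, nullity, kc_insert_of_isSelfLoop he, kc_delEdges, hcard]
    omega
  have hf₀ : G.nflags (delEdges e B) = (G.del e).nflags B + 2 := by
    rw [nflags, nflags, card_delEdges]
    omega
  have hf₁ : G.nflags (insert e (delEdges e B)) = (G.del e).nflags B := by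
    rw [nflags, nflags, hcard]
    omega
  rw [hc₀, hc₁, hn₀, hn₁, hf₀, hf₁]
  ring

end FlagGraph

/-- For a self-loop `e` of a graph with flags `G`,
`𝒯_{G/e} = 𝒯_{G−e} = t^{-2} 𝒯_{G∨e}`, and
`𝒯_G = (y - 1 + t²) ⬝ 𝒯_{G−e}`. -/
theorem tutte_flags_self_loop
    {K : Type*} [Field K] (x y t : K) (ht : t ≠ 0)
    (G : FlagGraph) (e : G.E) (he : G.IsSelfLoop e) :
    (G.contract e).T x y t = (G.del e).T x y t ∧
    (G.del e).T x y t = t ^ (-2 : ℤ) * (G.cut e).T x y t ∧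
    G.T x y t = (y - 1 + t ^ 2) * (G.del e).T x y t := by
  refine ⟨?_, ?_, FlagGraph.T_of_isSelfLoop x y t he⟩
  · rw [FlagGraph.contract, if_pos he]
  · rw [FlagGraph.T_cut_s3, ← mul_assoc, ← zpow_natCast, ← zpow_add₀ ht]
    simp
end

section
/- Let G be a rank D colored tensor graph (possibly with flags). Then: (i) contracting any edge of G does not change its boundary graph, i.e. ∂(G/e) = ∂G; (ii) contracting all edges of G in an arbitrary order yields a graph G⁰ with no edges which, up to additional trivial disc vertices, consists of the stranded vertices determined by the boundary graph ∂G (one vertex per connected component of ∂G). -/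
/-!
# Statement 12

Let `G` be a rank `D` colored tensor graph (possibly with flags).  Then:
(i) contracting any edge of `G` does not change its boundary graph, i.e.
`∂(G/e) = ∂G`; (ii) contracting all edges of `G` in an arbitrary order yields
a graph `G⁰` with no edges which, up to additional trivial disc vertices,
consists of the stranded vertices determined by the boundary graph `∂G` (one
vertex per connected component of `∂G`).

Rank `D` colored stranded graphs are modelled as follows.  `P` is the finite
set of pre-flags, each with a color `col p ∈ {0,…,D}`; the pre-flag `p` has
the `D` points `(p, c)`, `c ≠ col p` (the point `(p, c)` lying on the strand
of color pair `{col p, c}`).  The internal strand structure (the bows) is a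
fixed-point-free involution `bow` on the genuine points preserving color
pairs; a vertex is a connected component of pre-flags under the bows.  Edges
are recorded by a color-preserving involution `eps` on pre-flags: pre-flags
`p ≠ eps p` are paired into an edge whose `D` parallel strands join the
points `(p, c)` and `(eps p, c)`, while fixed pre-flags carry flags.  `G` is
a colored tensor graph when each vertex follows the pattern of the complete
graph `K_{D+1}`: the bow at the point `(p, c)` joins it to the point of color
label `col p` of the (unique) color-`c` pre-flag of the vertex.

The faces are the maximal connected components of points under bows and edge
strands; a face is open when it reaches a point of a flag; the boundary graph
`∂G` has the flags of `G` as vertices and the open faces as edges.  The soft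
contraction `G/e` of the edge `e = {p₀, q₀}` removes the pre-flags `p₀, q₀`
(the inner faces entirely contained in `e` and its end vertices becoming
trivial disc vertices, which are discarded here — "up to additional trivial
disc vertices") and re-bows the remaining points by following the old bows
and the strands of `e`: the new bow of a point `x` is the endpoint, outside
`e`, of the alternating chain of strands of `e` and bows starting with the
old bow of `x`.  A graph `G'` together with an identification `φ` of its
pre-flags with those of `G` other than `p₀, q₀` is *the* contraction of `e`
when its colors, edges and bows are exactly the ones so induced. -/

/-- A rank `D` colored stranded graph: colored pre-flags, a color-pair
preserving fixed-point-free involution `bow` pairing the genuine strand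
points inside the vertices, and a color-preserving involution `eps` pairing
pre-flags into (parallel-stranded) edges, whose fixed points carry flags. -/
structure Stranded (D : ℕ) where
  P : Type
  pFin : Fintype P
  pDec : DecidableEq P
  col : P → Fin (D + 1)
  bow : P × Fin (D + 1) → P × Fin (D + 1)
  bow_invol : ∀ x, bow (bow x) = x
  bow_fix : ∀ p : P, bow (p, col p) = (p, col p)
  bow_proper : ∀ x : P × Fin (D + 1), x.2 ≠ col x.1 → bow x ≠ x
  bow_pair : ∀ x : P × Fin (D + 1),
    ({col x.1, x.2} : Finset (Fin (D + 1))) = {col (bow x).1, (bow x).2}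
  eps : P → P
  eps_invol : ∀ p, eps (eps p) = p
  eps_col : ∀ p, col (eps p) = col p

attribute [instance] Stranded.pFin Stranded.pDec

namespace Stranded

variable {D : ℕ} (G : Stranded D)

/-- The pre-flag `p` carries a flag. -/
def IsFlag (p : G.P) : Prop := G.eps p = p

/-- `G` is a rank `D` colored tensor graph: each vertex consists of `D+1`
pre-flags of distinct colors following the pattern of the complete graph
`K_{D+1}` (the bow at the point `(p, c)` reaches the color-`c` pre-flag of
the vertex at its point of color label `col p`, consistently). -/
def IsColoredTensor : Prop :=
  (∀ (p : G.P) (c : Fin (D + 1)), c ≠ G.col p →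
    G.col (G.bow (p, c)).1 = c ∧ (G.bow (p, c)).2 = G.col p) ∧
  (∀ (p : G.P) (c c' : Fin (D + 1)), c ≠ G.col p → c' ≠ G.col p → c' ≠ c →
    (G.bow ((G.bow (p, c)).1, c')).1 = (G.bow (p, c')).1)

/-- One step along the face structure of `G`: a bow or an edge strand. -/
def faceStep (x y : G.P × Fin (D + 1)) : Prop :=
  y = G.bow x ∨ (G.eps x.1 ≠ x.1 ∧ y = (G.eps x.1, x.2))

/-- Two points lie on the same face of `G`. -/
def sameFace : G.P × Fin (D + 1) → G.P × Fin (D + 1) → Prop :=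
  Relation.EqvGen G.faceStep

/-- Two pre-flags are adjacent via a bow. -/
def bowAdj (p q : G.P) : Prop := ∃ c : Fin (D + 1), (G.bow (p, c)).1 = q

/-- One step of the alternating chain through the edge `{p₀, q₀}`: from a
point of the edge, cross its strand and take the bow at the other side. -/
def chainStep (p₀ q₀ : G.P) (z z' : G.P × Fin (D + 1)) : Prop :=
  (z.1 = p₀ ∨ z.1 = q₀) ∧ z' = G.bow (G.eps z.1, z.2)

/-- `y` is the new bow of `x` after contracting the edge `{p₀, q₀}`: the
endpoint, outside the edge, of the alternating chain of strands of the edge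
and bows starting with the old bow of `x`. -/
def NewBow (p₀ q₀ : G.P) (x y : G.P × Fin (D + 1)) : Prop :=
  Relation.ReflTransGen (G.chainStep p₀ q₀) (G.bow x) y ∧ y.1 ≠ p₀ ∧ y.1 ≠ q₀

/-- `G'`, with pre-flags identified via `φ` with the pre-flags of `G` other
than the two end pre-flags `p₀, q₀` of an edge, is the soft contraction
`G/e` of the edge `e = {p₀, q₀}` (up to trivial disc vertices): colors and
the remaining edges are unchanged, and the bows of `G'` are the chains of
`G` through `e`. -/
def IsContractionVia (p₀ q₀ : G.P) (G' : Stranded D)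
    (φ : G'.P ≃ {r : G.P // r ≠ p₀ ∧ r ≠ q₀}) : Prop :=
  (∀ r : G'.P, G'.col r = G.col (φ r).1) ∧
  (∀ r : G'.P, ((φ (G'.eps r)) : G.P) = G.eps ((φ r) : G.P)) ∧
  (∀ (r s : G'.P) (c c' : Fin (D + 1)),
    G'.bow (r, c) = (s, c') ↔ G.NewBow p₀ q₀ ((φ r : G.P), c) ((φ s : G.P), c'))

/-- `G'` is the soft contraction of the edge `{p₀, q₀}` of `G`, up to trivial
disc vertices. -/
def IsContraction (p₀ q₀ : G.P) (G' : Stranded D) : Prop :=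
  ∃ φ : G'.P ≃ {r : G.P // r ≠ p₀ ∧ r ≠ q₀}, G.IsContractionVia p₀ q₀ G' φ

end Stranded

/-- One soft edge contraction step (up to trivial disc vertices). -/
def ContractStep (D : ℕ) : Stranded D → Stranded D → Prop :=
  fun G G' => ∃ p₀ q₀ : G.P, G.eps p₀ = q₀ ∧ p₀ ≠ q₀ ∧ G.IsContraction p₀ q₀ G'

namespace Stranded

variable {D : ℕ} {G : Stranded D}

/-- Crossing an edge strand (trivially at a flag). -/
def cross (G : Stranded D) (z : G.P × Fin (D + 1)) : G.P × Fin (D + 1) := (G.eps z.1, z.2)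

theorem cross_cross (z : G.P × Fin (D + 1)) : G.cross (G.cross z) = z := by
  simp [cross, G.eps_invol]

theorem sameFace_bow (z : G.P × Fin (D + 1)) : G.sameFace z (G.bow z) :=
  .rel _ _ (.inl rfl)

theorem sameFace_cross (z : G.P × Fin (D + 1)) : G.sameFace z (G.cross z) := by
  by_cases h : G.eps z.1 = z.1
  · have : G.cross z = z := Prod.ext h rfl
    rw [this]
    exact .refl _
  · exact .rel _ _ (.inr ⟨h, rfl⟩)

theorem sameFace_iff_of_bow_of_cross {Q : G.P × Fin (D + 1) → Prop}
    (hbow : ∀ z, Q z → Q (G.bow z)) (hcross : ∀ z, Q z → Q (G.cross z))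
    {x y : G.P × Fin (D + 1)} (h : G.sameFace x y) : Q x ↔ Q y := by
  induction h with
  | rel x y h =>
    rcases h with rfl | ⟨-, rfl⟩
    · exact ⟨hbow x, fun h => G.bow_invol x ▸ hbow _ h⟩
    · exact ⟨hcross x, fun h => cross_cross x ▸ hcross _ h⟩
  | refl => rfl
  | symm _ _ _ ih => exact ih.symm
  | trans _ _ _ _ _ ih₁ ih₂ => exact ih₁.trans ih₂

theorem chainStep_rightUnique (p₀ q₀ : G.P) : Relator.RightUnique (G.chainStep p₀ q₀) := by
  rintro a b c ⟨-, rfl⟩ ⟨-, rfl⟩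
  rfl

theorem chain_eq_of_outer {p₀ q₀ : G.P} {z w : G.P × Fin (D + 1)}
    (h : Relation.ReflTransGen (G.chainStep p₀ q₀) z w) (h₁ : z.1 ≠ p₀) (h₂ : z.1 ≠ q₀) :
    w = z := by
  rcases h.cases_head with rfl | ⟨_, ⟨h, -⟩, -⟩
  · rfl
  · exact (h.elim h₁ h₂).elim

/-- A chain with an outer end can be continued from any point reachable from its start. -/
theorem chain_of_chain_of_outer {p₀ q₀ : G.P} {a z w : G.P × Fin (D + 1)}
    (hz : Relation.ReflTransGen (G.chainStep p₀ q₀) a z)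
    (hw : Relation.ReflTransGen (G.chainStep p₀ q₀) a w) (h₁ : w.1 ≠ p₀) (h₂ : w.1 ≠ q₀) :
    Relation.ReflTransGen (G.chainStep p₀ q₀) z w := by
  rcases Relation.ReflTransGen.total_of_right_unique (chainStep_rightUnique p₀ q₀) hz hw with h | h
  · exact h
  · rw [chain_eq_of_outer h h₁ h₂]

theorem eps_mem_edge_iff {p₀ q₀ : G.P} (he : G.eps p₀ = q₀) (p : G.P) :
    (G.eps p = p₀ ∨ G.eps p = q₀) ↔ (p = p₀ ∨ p = q₀) := by
  have := G.eps_invol p₀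
  have := G.eps_invol p
  constructor <;> rintro (h | h) <;> grind

/-- Chains through an edge can be followed backwards. -/
theorem chain_reverse {p₀ q₀ : G.P} (he : G.eps p₀ = q₀) {z w : G.P × Fin (D + 1)}
    (hz : z.1 = p₀ ∨ z.1 = q₀) (h : Relation.ReflTransGen (G.chainStep p₀ q₀) z w)
    (h₁ : w.1 ≠ p₀) (h₂ : w.1 ≠ q₀) :
    Relation.ReflTransGen (G.chainStep p₀ q₀) (G.bow w) (G.cross z) := by
  induction h using Relation.ReflTransGen.head_induction_on with
  | refl => exact (hz.elim h₁ h₂).elim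
  | @head z z' hs ht ih =>
    have hz' : G.bow z' = G.cross z := by rw [hs.2, G.bow_invol]; rfl
    by_cases hin : z'.1 = p₀ ∨ z'.1 = q₀
    · refine (ih hin).tail ⟨(eps_mem_edge_iff he _).2 hin, ?_⟩
      rw [← hz']
      exact congrArg G.bow (cross_cross z').symm
    · push Not at hin
      rw [chain_eq_of_outer ht hin.1 hin.2, hz']

theorem sameFace_of_chain {p₀ q₀ : G.P} {z w : G.P × Fin (D + 1)}
    (h : Relation.ReflTransGen (G.chainStep p₀ q₀) z w) : G.sameFace z w := by
  induction h with
  | refl => exact .refl _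
  | tail _ h ih =>
    rw [h.2]
    exact .trans _ _ _ ih (.trans _ _ _ (sameFace_cross _) (sameFace_bow _))

namespace IsContractionVia

variable {p₀ q₀ : G.P} {G' : Stranded D} {φ : G'.P ≃ {r : G.P // r ≠ p₀ ∧ r ≠ q₀}}

theorem isFlag_iff (h : G.IsContractionVia p₀ q₀ G' φ) (r : G'.P) :
    G'.IsFlag r ↔ G.IsFlag (φ r : G.P) := by
  unfold IsFlag
  rw [← h.2.1, Subtype.val_inj, φ.apply_eq_iff_eq]

theorem newBow (h : G.IsContractionVia p₀ q₀ G' φ) (y : G'.P × Fin (D + 1)) :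
    G.NewBow p₀ q₀ ((φ y.1 : G.P), y.2) ((φ (G'.bow y).1 : G.P), (G'.bow y).2) :=
  (h.2.2 _ _ _ _).1 rfl

theorem sameFace_map (h : G.IsContractionVia p₀ q₀ G' φ) {x y : G'.P × Fin (D + 1)}
    (hxy : G'.sameFace x y) : G.sameFace ((φ x.1 : G.P), x.2) ((φ y.1 : G.P), y.2) := by
  refine (sameFace_iff_of_bow_of_cross
    (Q := fun y => G.sameFace ((φ x.1 : G.P), x.2) ((φ y.1 : G.P), y.2)) ?_ ?_ hxy).1 (.refl _)
  · intro z hz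
    exact .trans _ _ _ hz (.trans _ _ _ (sameFace_bow _) (sameFace_of_chain (h.newBow z).1))
  · intro z hz
    refine .trans _ _ _ hz ?_
    have := sameFace_cross (G := G) ((φ z.1 : G.P), z.2)
    simp only [cross, h.2.1] at this ⊢
    exact this

theorem sameFace_of_map (he : G.eps p₀ = q₀) (h : G.IsContractionVia p₀ q₀ G' φ)
    {x y : G'.P × Fin (D + 1)}
    (hxy : G.sameFace ((φ x.1 : G.P), x.2) ((φ y.1 : G.P), y.2)) : G'.sameFace x y := by
  let Q : G.P × Fin (D + 1) → Prop := fun z => ∃ w : G'.P × Fin (D + 1),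
    Relation.ReflTransGen (G.chainStep p₀ q₀) z ((φ w.1 : G.P), w.2) ∧ G'.sameFace x w
  have outer (w : G'.P × Fin (D + 1)) (hw : Q ((φ w.1 : G.P), w.2)) : G'.sameFace x w := by
    obtain ⟨v, hv, hxv⟩ := hw
    have := chain_eq_of_outer hv (φ w.1).2.1 (φ w.1).2.2
    have h₁ := φ.injective (Subtype.ext (Prod.ext_iff.1 this).1)
    have h₂ := (Prod.ext_iff.1 this).2
    rwa [← Prod.ext h₁ h₂]
  have crossInner (z : G.P × Fin (D + 1)) (hz : z.1 = p₀ ∨ z.1 = q₀) (hq : Q z) :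
      Q (G.cross z) := by
    obtain ⟨w, hw, hxw⟩ := hq
    have hr := chain_reverse he hz hw (φ w.1).2.1 (φ w.1).2.2
    obtain ⟨hn, hn₁, hn₂⟩ := h.newBow w
    exact ⟨G'.bow w, chain_of_chain_of_outer hr hn hn₁ hn₂, .trans _ _ _ hxw (sameFace_bow w)⟩
  have lift (z : G.P × Fin (D + 1)) (hz : ¬ (z.1 = p₀ ∨ z.1 = q₀)) :
      ∃ w : G'.P × Fin (D + 1), z = ((φ w.1 : G.P), w.2) := by
    push Not at hz
    exact ⟨(φ.symm ⟨z.1, hz⟩, z.2), by simp⟩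
  refine outer y ((sameFace_iff_of_bow_of_cross ?_ ?_ hxy).1 ⟨x, .refl, .refl _⟩)
  · intro z hz
    by_cases hin : z.1 = p₀ ∨ z.1 = q₀
    · obtain ⟨w, hw, hxw⟩ := crossInner z hin hz
      refine ⟨w, chain_of_chain_of_outer (.single ⟨(eps_mem_edge_iff he _).2 hin, ?_⟩) hw
        (φ w.1).2.1 (φ w.1).2.2, hxw⟩
      exact congrArg G.bow (cross_cross z).symm
    · obtain ⟨w, rfl⟩ := lift z hin
      exact ⟨G'.bow w, (h.newBow w).1, .trans _ _ _ (outer w hz) (sameFace_bow w)⟩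
  · intro z hz
    by_cases hin : z.1 = p₀ ∨ z.1 = q₀
    · exact crossInner z hin hz
    · obtain ⟨w, rfl⟩ := lift z hin
      refine ⟨G'.cross w, ?_, .trans _ _ _ (outer w hz) (sameFace_cross w)⟩
      simp only [cross, h.2.1]
      exact .refl

theorem sameFace_iff (he : G.eps p₀ = q₀) (h : G.IsContractionVia p₀ q₀ G' φ)
    (x y : G'.P × Fin (D + 1)) :
    G'.sameFace x y ↔ G.sameFace ((φ x.1 : G.P), x.2) ((φ y.1 : G.P), y.2) :=
  ⟨h.sameFace_map, h.sameFace_of_map he⟩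

/-- The flags of a contraction are those of the graph. -/
noncomputable def flagEquiv (he : G.eps p₀ = q₀) (hne : p₀ ≠ q₀)
    (h : G.IsContractionVia p₀ q₀ G' φ) :
    {r : G'.P // G'.IsFlag r} ≃ {p : G.P // G.IsFlag p} :=
  Equiv.ofBijective (fun r => ⟨φ r.1, (h.isFlag_iff r.1).1 r.2⟩) <| by
    constructor
    · intro r s hrs
      have hv : (φ r.1 : G.P) = φ s.1 := Subtype.mk.inj hrs
      exact Subtype.ext (φ.injective (Subtype.ext hv))
    · rintro ⟨p, hp⟩
      have hp' : p ≠ p₀ ∧ p ≠ q₀ := by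
        constructor
        · rintro rfl
          exact hne (hp.symm.trans he)
        · rintro rfl
          exact hne (by rw [← G.eps_invol p₀, he]; exact hp)
      refine ⟨⟨φ.symm ⟨p, hp'⟩, (h.isFlag_iff _).2 (by simpa using hp)⟩, ?_⟩
      simp

end IsContractionVia

theorem exists_flagEquiv_of_contractSteps {G0 : Stranded D}
    (h : Relation.ReflTransGen (ContractStep D) G G0) :
    ∃ ψ : {r : G0.P // G0.IsFlag r} ≃ {p : G.P // G.IsFlag p},
      (∀ r : {r : G0.P // G0.IsFlag r}, G0.col r = G.col (ψ r : G.P)) ∧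
      ∀ (r s : {r : G0.P // G0.IsFlag r}) (c c' : Fin (D + 1)), G0.sameFace ((r : G0.P), c) ((s : G0.P), c') ↔
        G.sameFace ((ψ r : G.P), c) ((ψ s : G.P), c') := by
  induction h with
  | refl => exact ⟨.refl _, fun _ => rfl, fun _ _ _ _ => .rfl⟩
  | tail _ hs ih =>
    obtain ⟨ψ, hcol, hface⟩ := ih
    obtain ⟨p₀, q₀, he, hne, φ, hφ⟩ := hs
    refine ⟨(hφ.flagEquiv he hne).trans ψ, fun r => ?_, fun r s c c' => ?_⟩
    · exact (hφ.1 r).trans (hcol (hφ.flagEquiv he hne r))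
    · exact (hφ.sameFace_iff he _ _).trans
        (hface (hφ.flagEquiv he hne r) (hφ.flagEquiv he hne s) c c')

theorem eq_or_eq_bow_of_sameFace (hG : ∀ p, G.IsFlag p) {x y : G.P × Fin (D + 1)}
    (h : G.sameFace x y) : y = x ∨ y = G.bow x := by
  refine (sameFace_iff_of_bow_of_cross (Q := fun y => y = x ∨ y = G.bow x) ?_ ?_ h).1 (.inl rfl)
  · rintro z (rfl | rfl)
    · exact .inr rfl
    · exact .inl (G.bow_invol x)
  · intro z hz
    have : G.cross z = z := Prod.ext (hG z.1) rfl
    rwa [this]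

/-- Without edges, the vertices are the connected components of the boundary graph. -/
theorem nonempty_quot_bowAdj_equiv (hG : ∀ p, G.IsFlag p) {α : Type} (e : G.P ≃ α)
    {R : α → α → Prop} (hR : ∀ r s, R (e r) (e s) ↔ ∃ c c', G.sameFace (r, c) (s, c')) :
    Nonempty (Quot G.bowAdj ≃ Quot R) := by
  refine ⟨⟨Quot.lift (fun r => Quot.mk R (e r)) ?_,
    Quot.lift (fun a => Quot.mk G.bowAdj (e.symm a)) ?_, ?_, ?_⟩⟩
  · rintro r s ⟨c, rfl⟩
    exact Quot.sound ((hR _ _).2 ⟨c, (G.bow (r, c)).2, sameFace_bow _⟩)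
  · intro a b hab
    rw [← e.apply_symm_apply a, ← e.apply_symm_apply b, hR] at hab
    obtain ⟨c, c', hf⟩ := hab
    rcases eq_or_eq_bow_of_sameFace hG hf with h | h
    · exact congrArg _ (Prod.ext_iff.1 h).1.symm
    · exact Quot.sound ⟨c, (Prod.ext_iff.1 h).1.symm⟩
  · rintro ⟨r⟩
    simp
  · rintro ⟨a⟩
    simp

end Stranded

/-- Let `G` be a rank `D` colored tensor graph (possibly
with flags).  (i) Contracting any edge `e = {p₀, q₀}` of `G` does not change
its boundary graph: the flags of `G/e` are those of `G` and two flag points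
lie on a common (open) face of `G/e` exactly when they do in `G`, so that
`∂(G/e) = ∂G`.  (ii) Contracting all edges of `G` in an arbitrary order
yields a graph `G⁰` without edges which, up to the discarded trivial disc
vertices, is determined by the boundary: its pre-flags are identified with
the flags of `G` compatibly with the colors and with the face structure
(`∂G⁰ = ∂G`), and its stranded vertices are in bijection with the connected
components of the boundary graph `∂G`. -/
theorem coloredTensor_contraction_preserves_boundary
    (D : ℕ) (G : Stranded D) (hG : G.IsColoredTensor) :
    -- (i) one soft edge contraction does not change the boundary graph
    (∀ (p₀ q₀ : G.P), G.eps p₀ = q₀ → p₀ ≠ q₀ →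
      ∀ (G' : Stranded D) (φ : G'.P ≃ {r : G.P // r ≠ p₀ ∧ r ≠ q₀}),
        G.IsContractionVia p₀ q₀ G' φ →
        (∀ r : G'.P, G'.IsFlag r ↔ G.IsFlag (φ r : G.P)) ∧
        (∀ (r s : G'.P) (c c' : Fin (D + 1)),
          G'.IsFlag r → G'.IsFlag s →
            (G'.sameFace (r, c) (s, c') ↔
              G.sameFace ((φ r : G.P), c) ((φ s : G.P), c')))) ∧
    -- (ii) a full contraction is determined by the boundary graph of `G`
    (∀ G0 : Stranded D, Relation.ReflTransGen (ContractStep D) G G0 →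
      (∀ p : G0.P, G0.IsFlag p) →
      (∃ ψ : G0.P ≃ {p : G.P // G.IsFlag p},
        (∀ r : G0.P, G0.col r = G.col (ψ r : G.P)) ∧
        (∀ (r s : G0.P) (c c' : Fin (D + 1)),
          G0.sameFace (r, c) (s, c') ↔
            G.sameFace ((ψ r : G.P), c) ((ψ s : G.P), c'))) ∧
      Nonempty (Quot G0.bowAdj ≃
        Quot (fun f g : {p : G.P // G.IsFlag p} =>
          ∃ c c' : Fin (D + 1), G.sameFace ((f : G.P), c) ((g : G.P), c')))) := by
  refine ⟨fun p₀ q₀ he _ G' φ h => ⟨h.isFlag_iff, fun r s c c' _ _ => h.sameFace_iff he _ _⟩,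
    fun G0 h hflag => ?_⟩
  obtain ⟨ψ, hcol, hface⟩ := Stranded.exists_flagEquiv_of_contractSteps h
  let e : G0.P ≃ {p : G.P // G.IsFlag p} := (Equiv.subtypeUnivEquiv hflag).symm.trans ψ
  have he (r s : G0.P) (c c' : Fin (D + 1)) : G0.sameFace (r, c) (s, c') ↔
      G.sameFace ((e r : G.P), c) ((e s : G.P), c') := hface ⟨r, hflag r⟩ ⟨s, hflag s⟩ c c'
  exact ⟨⟨e, fun r => hcol ⟨r, hflag r⟩, he⟩,
    Stranded.nonempty_quot_bowAdj_equiv hflag e fun r s => by simp only [he]⟩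
end

section
/- Let G be a rank D colored tensor graph with n vertices and N flags. If some color of {0,…,D} does not appear among the colors of the flags of G, then n is even, N is even, and the colors occurring on the flags occur an even number of times each (the flag colors appear in pairs). -/
/-!
# Statement 14

Let `G` be a rank `D` colored tensor graph with `n` vertices and `N` flags.
If some color of `{0,…,D}` does not appear among the colors of the flags of
`G`, then `n` is even, `N` is even, and each color occurring on the flags
occurs an even number of times.

A rank `D` colored tensor graph is modelled at the combinatorial level: each
vertex `v` carries one pre-flag `(v, i)` of each color `i ∈ {0,…,D}`; the
graph is determined by a color-preserving involution `eps` on the set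
`V × Fin (D+1)` of pre-flags, whose two-element orbits are the edges (joining
pre-flags of the same color at vertices of opposite parities, by
bipartiteness) and whose fixed points are the flags (each flag inheriting the
color of the pre-flag it occupies). -/

/-- A rank `D` colored tensor graph: a finite bipartite vertex set (`sgn` is
the bipartition), each vertex carrying one pre-flag of each of the `D+1`
colors, with a color-preserving involution `eps` pairing pre-flags into edges
(moving between the two classes of the bipartition) and fixing exactly the
pre-flags occupied by flags. -/
structure ColoredTensor (D : ℕ) where
  V : Type
  vFin : Fintype V
  vDec : DecidableEq V
  sgn : V → Bool
  eps : V × Fin (D + 1) → V × Fin (D + 1)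
  eps_invol : ∀ p, eps (eps p) = p
  eps_col : ∀ p, (eps p).2 = p.2
  eps_bipartite : ∀ p, eps p ≠ p → sgn (eps p).1 = !sgn p.1

attribute [instance] ColoredTensor.vFin ColoredTensor.vDec

/-- The number of fixed points of an involution on a finite type has the parity of its
cardinality. -/
theorem Function.Involutive.even_card_fixed_iff {α : Type*} [Fintype α] {f : α → α}
    (hf : Function.Involutive f) :
    Even (Nat.card {x // f x = x}) ↔ Even (Fintype.card α) := by
  classical
  have h := Equiv.Perm.card_fixedPoints_modEq (f := f) (p := 2) (n := 1) <|
    (pow_two (M := Function.End α) f).trans (funext hf)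
  have e : Nat.card {x // f x = x} = Fintype.card (Function.fixedPoints f) := by
    rw [← Nat.card_eq_fintype_card]
    rfl
  rw [e, Nat.even_iff, Nat.even_iff, h]

namespace ColoredTensor

variable {D : ℕ} (G : ColoredTensor D)

/-- The map sending a vertex to its neighbour along the edge of color `i`, or to itself if its
pre-flag of color `i` is occupied by a flag. -/
def neighbor (i : Fin (D + 1)) (v : G.V) : G.V := (G.eps (v, i)).1

theorem eps_mk (i : Fin (D + 1)) (v : G.V) : G.eps (v, i) = (G.neighbor i v, i) :=
  Prod.ext rfl (G.eps_col (v, i))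

theorem neighbor_involutive (i : Fin (D + 1)) : Function.Involutive (G.neighbor i) := by
  intro v
  have h := G.eps_invol (v, i)
  rw [G.eps_mk i v, eps_mk] at h
  exact congrArg Prod.fst h

theorem card_flags_of_color (i : Fin (D + 1)) :
    Nat.card {p : G.V × Fin (D + 1) // G.eps p = p ∧ p.2 = i} =
      Nat.card {v : G.V // G.neighbor i v = v} := by
  refine (Nat.card_congr (Equiv.ofBijective
    (fun v => ⟨(v.1, i), by rw [eps_mk, v.2], rfl⟩) ⟨?_, ?_⟩)).symm
  · intro v w h
    exact Subtype.ext (congrArg (fun p => p.1.1) h)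
  · rintro ⟨⟨v, j⟩, h, rfl⟩
    exact ⟨⟨v, congrArg Prod.fst h⟩, rfl⟩

theorem even_card_flags_of_color_iff (i : Fin (D + 1)) :
    Even (Nat.card {p : G.V × Fin (D + 1) // G.eps p = p ∧ p.2 = i}) ↔
      Even (Fintype.card G.V) := by
  rw [card_flags_of_color, (G.neighbor_involutive i).even_card_fixed_iff]

end ColoredTensor

/-- If, in a rank `D` colored tensor graph `G`, the color
`a` does not occur on any flag of `G`, then the number of vertices of `G` is
even, the number of flags of `G` is even, and for every color `i` the number
of flags of color `i` is even. -/
theorem coloredTensor_missing_flag_color_parity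
    (D : ℕ) (G : ColoredTensor D) (a : Fin (D + 1))
    (ha : ∀ p : G.V × Fin (D + 1), G.eps p = p → p.2 ≠ a) :
    Even (Fintype.card G.V) ∧
    Even (Nat.card {p : G.V × Fin (D + 1) // G.eps p = p}) ∧
    ∀ i : Fin (D + 1),
      Even (Nat.card {p : G.V × Fin (D + 1) // G.eps p = p ∧ p.2 = i}) := by
  have hV : Even (Fintype.card G.V) := by
    rw [← G.even_card_flags_of_color_iff a]
    have : IsEmpty {p : G.V × Fin (D + 1) // G.eps p = p ∧ p.2 = a} :=
      ⟨fun p => ha p.1 p.2.1 p.2.2⟩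
    simp
  refine ⟨hV, ?_, fun i => (G.even_card_flags_of_color_iff i).2 hV⟩
  rw [Function.Involutive.even_card_fixed_iff G.eps_invol, Fintype.card_prod]
  exact hV.mul_right _
end

section
/- Let G be any representative of a rank 3 w-colored graph and let e be a bridge of G. Then: (i) every face passing through e is open; (ii) the (three) open faces passing through e all belong to the same connected component of the boundary graph ∂G. -/
/-!
# Statement 16

Let `G` be any representative of a rank 3 w-colored graph and let `e` be a
bridge of `G`.  Then: (i) every face passing through `e` is open; (ii) the
(three) open faces passing through `e` all belong to the same connected
component of the boundary graph `∂G`.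

Representatives of rank 3 w-colored graphs are rank 3 colored stranded graphs,
modelled as follows.  `P` is the finite set of pre-flags, each with a color
`col p ∈ {0,1,2,3}`; the pre-flag `p` has the three points `(p, c)`,
`c ≠ col p` (the point `(p, c)` lying on the strand of color pair
`{col p, c}`).  The internal strand structure (the bows) is a fixed-point-free
involution `bow` on the genuine points preserving color pairs; a vertex is a
connected component of pre-flags under the bows.  Edges are recorded by a
color-preserving involution `eps` on pre-flags: pre-flags `p ≠ eps p` are
paired into an edge whose three parallel strands join the points `(p, c)` and
`(eps p, c)`, while fixed pre-flags carry flags.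

Faces are the (bicolored) maximal connected components of points under bows
and edge strands; a face is open when it reaches a point of a flag and closed
otherwise.  The boundary graph `∂G` has the flags as vertices and the open
faces as edges; two flags lie in the same connected component of `∂G` when
they are linked by a chain of open faces.  The edge `e = {p₀, q₀}` of color
`a = col p₀` carries the three strands of color pairs `(a a₁), (a a₂), (a a₃)`
starting at the three points `(p₀, c)`, `c ≠ a`, so that the faces through `e`
are the face-components of these points.  `e` is a bridge when cutting it
disconnects `p₀` from `q₀`.
-/
/-- A rank 3 colored stranded graph (the ambient class of all representatives
of rank 3 w-colored graphs): colored pre-flags, a color-pair preserving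
fixed-point-free involution `bow` pairing the genuine strand points inside the
vertices, and a color-preserving involution `eps` pairing pre-flags into
(parallel-stranded) edges, whose fixed points carry the flags. -/
structure Stranded3 where
  P : Type
  pFin : Fintype P
  pDec : DecidableEq P
  col : P → Fin 4
  bow : P × Fin 4 → P × Fin 4
  bow_invol : ∀ x, bow (bow x) = x
  bow_fix : ∀ p : P, bow (p, col p) = (p, col p)
  bow_proper : ∀ x : P × Fin 4, x.2 ≠ col x.1 → bow x ≠ x
  bow_pair : ∀ x : P × Fin 4,
    ({col x.1, x.2} : Finset (Fin 4)) = {col (bow x).1, (bow x).2}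
  eps : P → P
  eps_invol : ∀ p, eps (eps p) = p
  eps_col : ∀ p, col (eps p) = col p

attribute [instance] Stranded3.pFin Stranded3.pDec

namespace Stranded3

variable (G : Stranded3)

/-- Two pre-flags are adjacent via a bow. -/
def bowAdj (p q : G.P) : Prop := ∃ c : Fin 4, (G.bow (p, c)).1 = q

/-- Two pre-flags lie on the same vertex (vertices are the connected
components of pre-flags under the bows). -/
def sameVertex : G.P → G.P → Prop := Relation.EqvGen G.bowAdj

/-- One step along the face structure of `G`: a bow or an edge strand. -/
def faceStep (x y : G.P × Fin 4) : Prop :=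
  y = G.bow x ∨ (G.eps x.1 ≠ x.1 ∧ y = (G.eps x.1, x.2))

/-- Two points lie on the same face of `G`. -/
def sameFace : G.P × Fin 4 → G.P × Fin 4 → Prop :=
  Relation.EqvGen G.faceStep

/-- The pre-flag `p` carries a flag. -/
def IsFlag (p : G.P) : Prop := G.eps p = p

/-- One step of connectivity in `G` with the edge `{p₀, q₀}` cut: a bow, or
any edge other than `{p₀, q₀}`. -/
def cutAdj (p₀ q₀ : G.P) (p q : G.P) : Prop :=
  (∃ c : Fin 4, (G.bow (p, c)).1 = q) ∨ (G.eps p = q ∧ p ≠ p₀ ∧ p ≠ q₀)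

/-- `{p₀, q₀}` is a bridge: cutting it disconnects `p₀` from `q₀`. -/
def IsBridge (p₀ q₀ : G.P) : Prop :=
  ¬ Relation.EqvGen (G.cutAdj p₀ q₀) p₀ q₀

/-- Two flags lie in the same connected component of the boundary graph `∂G`
(vertices of `∂G`: the flags; edges of `∂G`: the open faces, an open face
joining the two flags at which it ends). -/
def sameBoundaryComponent (f g : G.P) : Prop :=
  Relation.EqvGen
    (fun f' g' => G.IsFlag f' ∧ G.IsFlag g' ∧
      ∃ c c' : Fin 4, G.sameFace (f', c) (g', c')) f g

end Stranded3

namespace Stranded3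

open Finset

theorem pair_eq_pair_cases {i j k l : Fin 4}
    (h : ({k, l} : Finset (Fin 4)) = {i, j}) : k = i ∧ l = j ∨ k = j ∧ l = i := by
  decide +revert

theorem card_zmod_two_eq_card_fixed {α : Type*} [DecidableEq α] (s : Finset α) (g : α → α)
    (hmem : ∀ x ∈ s, g x ∈ s) (hinv : ∀ x ∈ s, g (g x) = x) :
    (#s : ZMod 2) = #{x ∈ s | g x = x} := by
  have hmoved : ∑ x ∈ s with ¬ g x = x, (1 : ZMod 2) = 0 := by
    refine Finset.sum_involution (fun x _ => g x) (fun _ _ => by decide) ?_ ?_ ?_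
    · intro x hx _
      exact (mem_filter.1 hx).2
    · intro x hx
      obtain ⟨hs, hg⟩ := mem_filter.1 hx
      refine mem_filter.2 ⟨hmem x hs, fun h => hg ?_⟩
      rw [hinv x hs] at h
      exact h.symm
    · intro x hx
      exact hinv x (mem_filter.1 hx).1
  rw [← Finset.card_filter_add_card_filter_not (s := s) (fun x => g x = x), Nat.cast_add]
  simpa using hmoved

variable {G : Stranded3}

theorem sameFace_bow (x : G.P × Fin 4) : G.sameFace x (G.bow x) :=
  .rel _ _ (.inl rfl)

theorem sameFace_eps (x : G.P × Fin 4) : G.sameFace x (G.eps x.1, x.2) := by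
  by_cases h : G.eps x.1 = x.1
  · rw [h]
    exact .refl _
  · exact .rel _ _ (.inr ⟨h, rfl⟩)

/-- The color pair of a point is constant along faces. -/
theorem pair_eq_of_sameFace {x y : G.P × Fin 4} (h : G.sameFace x y) :
    ({G.col x.1, x.2} : Finset (Fin 4)) = {G.col y.1, y.2} := by
  induction h with
  | rel x y h =>
    rcases h with rfl | ⟨-, rfl⟩
    · exact G.bow_pair x
    · simp [G.eps_col]
  | refl => rfl
  | symm _ _ _ ih => exact ih.symm
  | trans _ _ _ _ _ ih₁ ih₂ => exact ih₁.trans ih₂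

theorem ne_col_of_sameFace {x y : G.P × Fin 4} (h : G.sameFace x y) (hx : x.2 ≠ G.col x.1) :
    y.2 ≠ G.col y.1 := by
  rcases pair_eq_pair_cases (pair_eq_of_sameFace h) with ⟨h₁, h₂⟩ | ⟨h₁, h₂⟩
  · rwa [← h₁, ← h₂]
  · rw [← h₁, ← h₂]
    exact hx.symm

/-- Strands of color pair `{i, j}` on the side of `p₀` of the cut end in pairs: the number of
ends of such strands, at flags or at the cut edge, lying on any given union of faces is even. -/
theorem card_strand_ends_eq_zero {p₀ q₀ : G.P} (hedge : G.eps p₀ = q₀)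
    (hbridge : G.IsBridge p₀ q₀) (V : Set (G.P × Fin 4))
    (hV : ∀ x y, G.sameFace x y → x ∈ V → y ∈ V) {i j : Fin 4} (hij : i ≠ j)
    (T : Finset (G.P × Fin 4))
    (hT : ∀ x, x ∈ T ↔ Relation.EqvGen (G.cutAdj p₀ q₀) p₀ x.1 ∧
      ({G.col x.1, x.2} : Finset (Fin 4)) = {i, j} ∧ x ∈ V ∧ (G.IsFlag x.1 ∨ x.1 = p₀)) :
    (#T : ZMod 2) = 0 := by
  classical
  let S : Finset (G.P × Fin 4) := {x | Relation.EqvGen (G.cutAdj p₀ q₀) p₀ x.1 ∧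
    ({G.col x.1, x.2} : Finset (Fin 4)) = {i, j} ∧ x ∈ V}
  have hS (x) : x ∈ S ↔ Relation.EqvGen (G.cutAdj p₀ q₀) p₀ x.1 ∧
      ({G.col x.1, x.2} : Finset (Fin 4)) = {i, j} ∧ x ∈ V := by simp [S]
  let g : G.P × Fin 4 → G.P × Fin 4 := fun x => if x.1 = p₀ then x else (G.eps x.1, x.2)
  have hq (x) (hx : x ∈ S) : x.1 ≠ q₀ := by
    intro h
    exact hbridge (h ▸ ((hS x).1 hx).1)
  have hbow : (#S : ZMod 2) = 0 := by
    rw [card_zmod_two_eq_card_fixed S G.bow]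
    · rw [filter_false_of_mem]
      · simp
      · intro x hx
        refine G.bow_proper x ?_
        rcases pair_eq_pair_cases ((hS x).1 hx).2.1 with ⟨h₁, h₂⟩ | ⟨h₁, h₂⟩
        · rw [h₁, h₂]
          exact hij.symm
        · rw [h₁, h₂]
          exact hij
    · intro x hx
      obtain ⟨hc, hp, hv⟩ := (hS x).1 hx
      exact (hS _).2 ⟨hc.trans _ _ _ (.rel _ _ (.inl ⟨x.2, rfl⟩)),
        (G.bow_pair x).symm.trans hp, hV _ _ (sameFace_bow x) hv⟩
    · exact fun x _ => G.bow_invol x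
  have hcut : (#S : ZMod 2) = #{x ∈ S | g x = x} := by
    refine card_zmod_two_eq_card_fixed S g ?_ ?_
    · intro x hx
      by_cases h : x.1 = p₀
      · simpa [g, h] using hx
      · obtain ⟨hc, hp, hv⟩ := (hS x).1 hx
        simp only [g, h, if_false]
        refine (hS _).2 ⟨hc.trans _ _ _ (.rel _ _ (.inr ⟨rfl, h, hq x hx⟩)), ?_,
          hV _ _ (sameFace_eps x) hv⟩
        simpa [G.eps_col] using hp
    · intro x hx
      by_cases h : x.1 = p₀
      · simp [g, h]
      · have h' : G.eps x.1 ≠ p₀ := by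
          intro h'
          apply hq x hx
          rw [← hedge, ← h', G.eps_invol]
        simp [g, h, h', G.eps_invol]
  have hTS : T = {x ∈ S | g x = x} := by
    ext x
    rw [hT, mem_filter, hS]
    by_cases h : x.1 = p₀ <;> simp [g, h, IsFlag, Prod.ext_iff, and_assoc]
  rw [hTS, ← hcut, hbow]

/-- A flag has exactly one point on each color pair containing its color. -/
theorem card_points_of_pair (N : Set G.P) {i j : Fin 4} (hij : i ≠ j)
    (T : Finset (G.P × Fin 4)) (A B : Finset G.P)
    (hT : ∀ x, x ∈ T ↔ x.1 ∈ N ∧ ({G.col x.1, x.2} : Finset (Fin 4)) = {i, j})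
    (hA : ∀ p, p ∈ A ↔ p ∈ N ∧ G.col p = i) (hB : ∀ p, p ∈ B ↔ p ∈ N ∧ G.col p = j) :
    #T = #A + #B := by
  have hinj (c : Fin 4) : Function.Injective fun p : G.P => (p, c) := fun _ _ h =>
    congrArg Prod.fst h
  have hTAB : T = A.image (fun p => (p, j)) ∪ B.image (fun p => (p, i)) := by
    ext ⟨p, c⟩
    simp only [hT, mem_union, mem_image, hA, hB, Prod.mk.injEq]
    constructor
    · rintro ⟨hp, h⟩
      rcases pair_eq_pair_cases h with ⟨h₁, h₂⟩ | ⟨h₁, h₂⟩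
      · exact .inl ⟨p, ⟨hp, h₁⟩, rfl, h₂.symm⟩
      · exact .inr ⟨p, ⟨hp, h₁⟩, rfl, h₂.symm⟩
    · rintro (⟨p, ⟨hp, h⟩, rfl, rfl⟩ | ⟨p, ⟨hp, h⟩, rfl, rfl⟩)
      · exact ⟨hp, by rw [h]⟩
      · exact ⟨hp, by rw [h, pair_comm]⟩
  rw [hTAB, card_union_of_disjoint, card_image_of_injective _ (hinj j),
    card_image_of_injective _ (hinj i)]
  rw [disjoint_left]
  intro x hx hx'
  obtain ⟨p, -, rfl⟩ := mem_image.1 hx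
  obtain ⟨p', -, h⟩ := mem_image.1 hx'
  exact hij (congrArg Prod.snd h)

/-- Every face through a bridge reaches a flag. -/
theorem exists_flag_of_isBridge {p₀ q₀ : G.P} (hedge : G.eps p₀ = q₀)
    (hbridge : G.IsBridge p₀ q₀) {c : Fin 4} (hc : c ≠ G.col p₀) :
    ∃ (r : G.P) (c' : Fin 4), G.IsFlag r ∧ c' ≠ G.col r ∧ G.sameFace (p₀, c) (r, c') := by
  classical
  by_contra hno
  have h := card_strand_ends_eq_zero hedge hbridge {x | G.sameFace (p₀, c) x}
    (fun x y hxy hx => hx.trans _ _ _ hxy) hc.symm {(p₀, c)} ?_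
  · simp at h
  · rintro ⟨p, d⟩
    simp only [mem_singleton, Set.mem_ofPred_eq]
    constructor
    · intro h
      obtain ⟨rfl, rfl⟩ := Prod.mk.inj h
      exact ⟨.refl _, rfl, .refl _, .inr rfl⟩
    · rintro ⟨-, hp, hv, hf | rfl⟩
      · exact (hno ⟨p, d, hf, ne_col_of_sameFace hv hc, hv⟩).elim
      · rcases pair_eq_pair_cases hp with ⟨-, rfl⟩ | ⟨h, -⟩
        · rfl
        · exact (hc h.symm).elim

/-- If one face through a bridge reaches a given boundary component, so does any other. -/
theorem exists_flag_sameBoundaryComponent {p₀ q₀ r : G.P} (hedge : G.eps p₀ = q₀)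
    (hne : p₀ ≠ q₀) (hbridge : G.IsBridge p₀ q₀) {c₁ c₂ d : Fin 4} (hc₁ : c₁ ≠ G.col p₀)
    (hc₂ : c₂ ≠ G.col p₀) (hr : G.IsFlag r) (hface : G.sameFace (p₀, c₁) (r, d)) :
    ∃ (s : G.P) (d' : Fin 4), G.IsFlag s ∧ G.sameBoundaryComponent r s ∧
      G.sameFace (p₀, c₂) (s, d') := by
  classical
  by_contra hno
  have h12 : c₁ ≠ c₂ := by
    rintro rfl
    exact hno ⟨r, d, hr, .refl _, hface⟩
  let V : Set (G.P × Fin 4) := {x | ∃ (s : G.P) (d' : Fin 4), G.IsFlag s ∧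
    G.sameBoundaryComponent r s ∧ G.sameFace x (s, d')}
  have hV : ∀ x y, G.sameFace x y → x ∈ V → y ∈ V := by
    rintro x y hxy ⟨s, d', hs, hrs, hx⟩
    exact ⟨s, d', hs, hrs, (hxy.symm _ _).trans _ _ _ hx⟩
  let N : Set G.P := {p | Relation.EqvGen (G.cutAdj p₀ q₀) p₀ p ∧ G.IsFlag p ∧
    G.sameBoundaryComponent r p}
  have hVN {p : G.P} (hp : G.IsFlag p) (c : Fin 4) :
      (p, c) ∈ V ↔ G.sameBoundaryComponent r p := by
    constructor
    · rintro ⟨s, d', hs, hrs, hx⟩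
      exact hrs.trans _ _ _ (.rel _ _ ⟨hs, hp, d', c, hx.symm _ _⟩)
    · exact fun h => ⟨p, c, hp, h, .refl _⟩
  have hp₀ : ¬ G.IsFlag p₀ := fun h => hne (h.symm.trans hedge)
  let n : Fin 4 → Finset G.P := fun i => {p | p ∈ N ∧ G.col p = i}
  let F : Fin 4 → Fin 4 → Finset (G.P × Fin 4) := fun i j =>
    {x | x.1 ∈ N ∧ ({G.col x.1, x.2} : Finset (Fin 4)) = {i, j}}
  have hF {i j : Fin 4} (hij : i ≠ j) : #(F i j) = #(n i) + #(n j) :=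
    card_points_of_pair N hij _ _ _ (by simp [F]) (by simp [n]) (by simp [n])
  have hnone {i j : Fin 4} (hij : i ≠ j)
      (h : ∀ c, ({G.col p₀, c} : Finset (Fin 4)) = {i, j} → (p₀, c) ∉ V) :
      ((#(n i) + #(n j) : ℕ) : ZMod 2) = 0 := by
    rw [← hF hij]
    refine card_strand_ends_eq_zero hedge hbridge V hV hij _ ?_
    rintro ⟨p, c⟩
    simp only [F, mem_filter, mem_univ, true_and, N, Set.mem_ofPred_eq]
    constructor
    · rintro ⟨⟨hc, hf, hb⟩, hp⟩
      exact ⟨hc, hp, (hVN hf c).2 hb, .inl hf⟩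
    · rintro ⟨hc, hp, hv, hf | rfl⟩
      · exact ⟨⟨hc, hf, (hVN hf c).1 hv⟩, hp⟩
      · exact (h c hp hv).elim
  have hone : ((#(n (G.col p₀)) + #(n c₁) : ℕ) : ZMod 2) + 1 = 0 := by
    rw [← hF hc₁.symm]
    have hmem : (p₀, c₁) ∉ F (G.col p₀) c₁ := by
      simp [F, N, hp₀]
    rw [← Nat.cast_add_one, ← card_insert_of_notMem hmem]
    refine card_strand_ends_eq_zero hedge hbridge V hV hc₁.symm _ ?_
    rintro ⟨p, c⟩
    simp only [F, mem_insert, mem_filter, mem_univ, true_and, N, Set.mem_ofPred_eq]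
    constructor
    · rintro (h | ⟨⟨hc, hf, hb⟩, hp⟩)
      · obtain ⟨rfl, rfl⟩ := Prod.mk.inj h
        exact ⟨.refl _, rfl, ⟨r, d, hr, .refl _, hface⟩, .inr rfl⟩
      · exact ⟨hc, hp, (hVN hf c).2 hb, .inl hf⟩
    · rintro ⟨hc, hp, hv, hf | rfl⟩
      · exact .inr ⟨⟨hc, hf, (hVN hf c).1 hv⟩, hp⟩
      · rcases pair_eq_pair_cases hp with ⟨-, rfl⟩ | ⟨h, -⟩
        · exact .inl rfl
        · exact (hc₁ h.symm).elim
  have h₁₂ := hnone h12 fun c hc => by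
    rcases pair_eq_pair_cases hc with ⟨h, -⟩ | ⟨h, -⟩
    · exact (hc₁ h.symm).elim
    · exact (hc₂ h.symm).elim
  have h₀₂ := hnone hc₂.symm fun c hc hv => by
    rcases pair_eq_pair_cases hc with ⟨-, rfl⟩ | ⟨h, -⟩
    · exact hno hv
    · exact hc₂ h.symm
  push_cast at hone h₁₂ h₀₂
  generalize (#(n (G.col p₀)) : ZMod 2) = a at *
  generalize (#(n c₁) : ZMod 2) = b at *
  generalize (#(n c₂) : ZMod 2) = c at *
  clear * - hone h₁₂ h₀₂
  revert a b c
  decide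

end Stranded3

/-- Let `e = {p₀, q₀}` be a bridge of a representative `G`
of a rank 3 w-colored graph.  Then (i) each of the three faces through `e`
(the face-components of the points `(p₀, c)`, `c ≠ col p₀`) is open, i.e.
reaches a point of a flag; and (ii) all the flags reached by these faces lie
in one and the same connected component of the boundary graph `∂G`. -/
theorem wcolored_bridge_faces_open_same_boundary_component
    (G : Stranded3) (p₀ q₀ : G.P)
    (hedge : G.eps p₀ = q₀) (hne : p₀ ≠ q₀)
    (hbridge : G.IsBridge p₀ q₀) :
    -- (i) every face passing through the bridge is open
    (∀ c : Fin 4, c ≠ G.col p₀ →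
      ∃ (r : G.P) (c' : Fin 4), G.IsFlag r ∧ c' ≠ G.col r ∧
        G.sameFace (p₀, c) (r, c')) ∧
    -- (ii) these open faces all belong to the same boundary component
    (∀ (c₁ c₂ : Fin 4), c₁ ≠ G.col p₀ → c₂ ≠ G.col p₀ →
      ∀ (r₁ r₂ : G.P) (c₁' c₂' : Fin 4),
        G.IsFlag r₁ → G.IsFlag r₂ →
        G.sameFace (p₀, c₁) (r₁, c₁') → G.sameFace (p₀, c₂) (r₂, c₂') →
        G.sameBoundaryComponent r₁ r₂) := by
  refine ⟨fun c hc => Stranded3.exists_flag_of_isBridge hedge hbridge hc, ?_⟩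
  intro c₁ c₂ hc₁ hc₂ r₁ r₂ c₁' c₂' hr₁ hr₂ h₁ h₂
  obtain ⟨s, d, hs, hrs, h⟩ :=
    Stranded3.exists_flag_sameBoundaryComponent hedge hne hbridge hc₁ hc₂ hr₁ h₁
  exact hrs.trans _ _ _ (.rel _ _ ⟨hs, hr₂, d, c₂', (h.symm _ _).trans _ _ _ h₂⟩)
end
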